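/- arXiv:1809.05135 — 4 statements merged into one kernel-verified Lean document; each statement's English description precedes it below -/
import Mathlib

section
/- Suppose f : [0,∞) × Ω → ℝ is jointly measurable with |f(t,ω)| ≤ 1 for all t and ω, and suppose there are constants C ≥ 0, κ > 0 and ε > 0 such that |E[f(t,·) f(s,·)]| ≤ C (ε + e^{-κ|t-s|/ε}) for all s, t ≥ 0. Then E[ ( ∫₀^∞ e^{-t} f(t,·) dt )² ] ≤ C ε (1 + 1/κ). -/
open MeasureTheory Real

lemma aux_lap (a : ℝ) (ha : 0 < a) :
    Integrable (fun x : ℝ => Real.exp (-a * |x|)) ∧ ∫ x : ℝ, Real.exp (-a * |x|) = 2 / a := by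
  have h1 : ∫ x : ℝ, Real.exp (-a * |x|) = 2 / a := by
    rw [integral_comp_abs (f := fun x => Real.exp (-a * x)),
      integral_exp_mul_Ioi (by linarith)]
    simp
    field_simp
  refine ⟨?_, h1⟩
  by_contra h
  rw [integral_undef h] at h1
  have : 0 < 2 / a := by positivity
  linarith

lemma aux_kernel (a : ℝ) (ha : 0 < a) :
    Integrable (fun z : ℝ × ℝ => Real.exp (-2 * z.1) * Real.exp (-a * |z.1 - z.2|))
      ((volume.restrict (Set.Ioi (0:ℝ))).prod (volume.restrict (Set.Ioi (0:ℝ)))) ∧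
    ∫ z : ℝ × ℝ, Real.exp (-2 * z.1) * Real.exp (-a * |z.1 - z.2|)
      ∂((volume.restrict (Set.Ioi (0:ℝ))).prod (volume.restrict (Set.Ioi (0:ℝ)))) ≤ 1 / a := by
  obtain ⟨hi, hv⟩ := aux_lap a ha
  have he : Integrable (fun t : ℝ => Real.exp (-2 * t)) (volume.restrict (Set.Ioi (0:ℝ))) :=
    integrableOn_exp_mul_Ioi (by norm_num) 0
  have hev : ∫ t in Set.Ioi (0:ℝ), Real.exp (-2 * t) = 1 / 2 := by
    rw [integral_exp_mul_Ioi (by norm_num)]; norm_num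
  have hsi : ∀ t : ℝ, Integrable (fun s : ℝ => Real.exp (-a * |t - s|)) := fun t =>
    hi.comp_sub_left t
  have hsv : ∀ t : ℝ, ∫ s : ℝ, Real.exp (-a * |t - s|) = 2 / a := fun t => by
    rw [← hv]; exact integral_sub_left_eq_self (fun x => Real.exp (-a * |x|)) volume t
  have hint : Integrable (fun z : ℝ × ℝ => Real.exp (-2 * z.1) * Real.exp (-a * |z.1 - z.2|))
      ((volume.restrict (Set.Ioi (0:ℝ))).prod volume) := by
    rw [integrable_prod_iff (by fun_prop)]
    refine ⟨.of_forall fun t => (hsi t).const_mul (Real.exp (-2 * t)), ?_⟩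
    simp only [norm_mul, Real.norm_eq_abs, Real.abs_exp, integral_const_mul, hsv]
    exact he.mul_const _
  have hle : (volume.restrict (Set.Ioi (0:ℝ))).prod (volume.restrict (Set.Ioi (0:ℝ)))
      ≤ (volume.restrict (Set.Ioi (0:ℝ))).prod volume :=
    Measure.prod_mono le_rfl Measure.restrict_le_self
  refine ⟨hint.mono_measure hle, ?_⟩
  calc _ ≤ ∫ z : ℝ × ℝ, Real.exp (-2 * z.1) * Real.exp (-a * |z.1 - z.2|)
      ∂((volume.restrict (Set.Ioi (0:ℝ))).prod volume) :=
        integral_mono_measure hle (.of_forall fun z => by positivity) hint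
    _ = 1 / a := by
      rw [integral_prod _ hint]
      simp only [integral_const_mul, hsv, integral_mul_const, hev]
      field_simp

lemma aux_main {Ω : Type*} [MeasurableSpace Ω] (P : Measure Ω) [IsProbabilityMeasure P]
    (f : ℝ → Ω → ℝ) (hf : Measurable (Function.uncurry f))
    (hbd : ∀ t, ∀ ω, |f t ω| ≤ 1)
    (C κ ε : ℝ) (hC : 0 ≤ C) (hκ : 0 < κ) (hε : 0 < ε)
    (hcov : ∀ s t, |∫ ω, f t ω * f s ω ∂P| ≤ C * (ε + Real.exp (-κ * |t - s| / ε))) :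
    (∫ ω, (∫ t in Set.Ioi (0:ℝ), Real.exp (-t) * f t ω) ^ 2 ∂P) ≤ C * ε * (1 + 1 / κ) := by
  obtain ⟨hk, hkv⟩ := aux_kernel (κ / ε) (by positivity)
  set μ := volume.restrict (Set.Ioi (0:ℝ)) with hμ
  have he : Integrable (fun t : ℝ => Real.exp (-t)) μ := by
    have h := integrableOn_exp_mul_Ioi (a := -1) (by norm_num) 0
    simp only [neg_mul, one_mul] at h
    exact h
  have hev : ∫ t, Real.exp (-t) ∂μ = 1 := by
    rw [hμ]; exact integral_exp_neg_Ioi_zero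
  have hee := he.mul_prod he
  have heev : ∫ z : ℝ × ℝ, Real.exp (-z.1) * Real.exp (-z.2) ∂(μ.prod μ) = 1 := by
    rw [integral_prod_mul (fun t => Real.exp (-t)) (fun t => Real.exp (-t)), hev, one_mul]
  have hm1 : Measurable (fun p : Ω × (ℝ × ℝ) => f p.2.1 p.1) :=
    hf.comp (measurable_snd.fst.prodMk measurable_fst)
  have hm2 : Measurable (fun p : Ω × (ℝ × ℝ) => f p.2.2 p.1) :=
    hf.comp (measurable_snd.snd.prodMk measurable_fst)
  have hG : Integrable (Function.uncurry fun (ω : Ω) (z : ℝ × ℝ) =>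
      (Real.exp (-z.1) * f z.1 ω) * (Real.exp (-z.2) * f z.2 ω)) (P.prod (μ.prod μ)) := by
    refine Integrable.mono' ((integrable_const (1:ℝ)).mul_prod hee) ?_ (.of_forall ?_)
    · apply Measurable.aestronglyMeasurable
      simp only [Function.uncurry_def]
      fun_prop
    · rintro ⟨ω, t, s⟩
      simp only [Function.uncurry, norm_mul, Real.norm_eq_abs, Real.abs_exp, one_mul]
      have h1 := hbd t ω
      have h2 := hbd s ω
      gcongr
      · exact mul_le_of_le_one_right (exp_pos _).le h1
      · exact mul_le_of_le_one_right (exp_pos _).le h2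
  have hsw : Integrable (fun z : ℝ × ℝ => Real.exp (-z.2) * Real.exp (-z.1)) (μ.prod μ) := by
    simpa only [mul_comm] using hee
  have hks : Integrable (fun z : ℝ × ℝ =>
      Real.exp (-2 * z.2) * Real.exp (-(κ / ε) * |z.2 - z.1|)) (μ.prod μ) := hk.swap
  have hadd : Integrable (fun z : ℝ × ℝ =>
      Real.exp (-2 * z.1) * Real.exp (-(κ / ε) * |z.1 - z.2|) +
      Real.exp (-2 * z.2) * Real.exp (-(κ / ε) * |z.2 - z.1|)) (μ.prod μ) := hk.add hks
  have hksv := integral_prod_swap (μ := μ) (ν := μ)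
    (fun z : ℝ × ℝ => Real.exp (-2 * z.1) * Real.exp (-(κ / ε) * |z.1 - z.2|))
  calc _ = ∫ ω, ∫ z : ℝ × ℝ, (Real.exp (-z.1) * f z.1 ω) * (Real.exp (-z.2) * f z.2 ω)
        ∂(μ.prod μ) ∂P := by
        congr 1; ext ω
        rw [integral_prod_mul (fun t => Real.exp (-t) * f t ω) (fun t => Real.exp (-t) * f t ω), sq]
    _ = ∫ z : ℝ × ℝ, ∫ ω, (Real.exp (-z.1) * f z.1 ω) * (Real.exp (-z.2) * f z.2 ω) ∂P
        ∂(μ.prod μ) := integral_integral_swap hG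
    _ ≤ ∫ z : ℝ × ℝ, (C * ε * (Real.exp (-z.1) * Real.exp (-z.2)) + C / 2 *
          (Real.exp (-2 * z.1) * Real.exp (-(κ / ε) * |z.1 - z.2|) +
           Real.exp (-2 * z.2) * Real.exp (-(κ / ε) * |z.2 - z.1|))) ∂(μ.prod μ) := by
        refine integral_mono hG.integral_prod_right
          ((hee.const_mul _).add (hadd.const_mul _)) ?_
        rintro ⟨t, s⟩
        have h1 : ∀ ω, (Real.exp (-t) * f t ω) * (Real.exp (-s) * f s ω)
          = (Real.exp (-t) * Real.exp (-s)) * (f t ω * f s ω) := fun ω => by ring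
        simp only [h1, integral_const_mul]
        have h2 := (le_abs_self _).trans (hcov s t)
        have h3 : -κ * |t - s| / ε = -(κ / ε) * |t - s| := by ring
        rw [h3] at h2
        rw [abs_sub_comm s t]
        have h4 : Real.exp (-2 * t) = Real.exp (-t) ^ 2 := by rw [← Real.exp_nat_mul]; norm_num
        have h5 : Real.exp (-2 * s) = Real.exp (-s) ^ 2 := by rw [← Real.exp_nat_mul]; norm_num
        rw [h4, h5]
        have h6 := mul_le_mul_of_nonneg_left h2
          (mul_pos (exp_pos (-t)) (exp_pos (-s))).le
        have h7 : 0 ≤ C * Real.exp (-(κ / ε) * |t - s|) * (Real.exp (-t) - Real.exp (-s)) ^ 2 := by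
          positivity
        linarith
    _ = C * ε * 1 + C / 2 * (∫ z : ℝ × ℝ, Real.exp (-2 * z.1) * Real.exp (-(κ / ε) * |z.1 - z.2|)
          ∂(μ.prod μ) + ∫ z : ℝ × ℝ, Real.exp (-2 * z.1) * Real.exp (-(κ / ε) * |z.1 - z.2|)
          ∂(μ.prod μ)) := by
        rw [integral_add (hee.const_mul _) (hadd.const_mul _), integral_const_mul,
          integral_const_mul, heev]
        congr 2
        refine (integral_add hk hks).trans ?_
        exact congrArg _ hksv
    _ ≤ C * ε * 1 + C / 2 * (1 / (κ / ε) + 1 / (κ / ε)) := by gcongr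
    _ = _ := by field_simp; ring

/-- If `f : [0,∞) × Ω → ℝ` is jointly measurable, bounded by `1`, and has covariance
bounded by `C (ε + e^{-κ|t-s|/ε})`, then `E[(∫₀^∞ e^{-t} f(t,·) dt)²] ≤ C ε (1 + 1/κ)`. -/
theorem stmt_2 {Ω : Type*} [MeasurableSpace Ω] (P : Measure Ω) [IsProbabilityMeasure P]
    (f : ℝ → Ω → ℝ) (hf : Measurable (Function.uncurry f))
    (hbd : ∀ t, 0 ≤ t → ∀ ω, |f t ω| ≤ 1)
    (C κ ε : ℝ) (hC : 0 ≤ C) (hκ : 0 < κ) (hε : 0 < ε)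
    (hcov : ∀ s t, 0 ≤ s → 0 ≤ t →
      |∫ ω, f t ω * f s ω ∂P| ≤ C * (ε + Real.exp (-κ * |t - s| / ε))) :
    (∫ ω, (∫ t in Set.Ioi (0:ℝ), Real.exp (-t) * f t ω) ^ 2 ∂P) ≤ C * ε * (1 + 1 / κ) := by
  have key := aux_main P (fun t ω => if 0 ≤ t then f t ω else 0) ?_ ?_ C κ ε hC hκ hε ?_
  · convert key using 4 with ω
    refine setIntegral_congr_fun measurableSet_Ioi fun t ht => ?_
    have ht' : (0:ℝ) ≤ t := le_of_lt ht
    simp [ht']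
  · exact Measurable.ite (measurableSet_le measurable_const measurable_fst) hf measurable_const
  · intro t ω
    by_cases h : 0 ≤ t
    · simpa [h] using hbd t h ω
    · simp [h]
  · intro s t
    by_cases h : 0 ≤ t
    · by_cases h' : 0 ≤ s
      · simpa [h, h'] using hcov s t h' h
      · simp only [h', if_false, mul_zero, integral_zero, abs_zero]; positivity
    · simp only [h, if_false, zero_mul, integral_zero, abs_zero]; positivity
end

section
/- Let n ≥ 1, γ ∈ (0,1), and let rᵢ, σᵢ, aᵢⱼ (1 ≤ i, j ≤ n) be reals with aᵢᵢ > 0 and aᵢⱼ ≥ 0 for all i, j. Then there exists a constant K such that for every x ∈ ℝⁿ with xᵢ > 0 for all i, Σᵢ [ γ (xᵢ^γ − 1)(rᵢ − Σⱼ aᵢⱼ xⱼ) + (γ/2) ((γ − 1) xᵢ^γ + 1) σᵢ² ] ≤ K. -/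
open Finset Real

lemma one_var_bound (γ : ℝ) (h0 : 0 < γ) (h1 : γ < 1) (R c a : ℝ) (hR : 0 ≤ R) (hc : 0 ≤ c)
    (ha : 0 < a) : ∃ K : ℝ, ∀ x : ℝ, 0 < x → R * (x ^ γ + 1) + c * x - a * x ^ γ * x ≤ K := by
  have hd : 0 ≤ (R + c) / a := by positivity
  refine ⟨(R + c) * ((R + c) / a) ^ (1 / γ) + 2 * R, fun x hx => ?_⟩
  have hp : 0 < x ^ γ := Real.rpow_pos_of_pos hx γ
  have hp1 : x ^ γ ≤ 1 + x := by
    rcases le_total x 1 with h | h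
    · have := Real.rpow_le_one hx.le h h0.le
      linarith
    · have := Real.rpow_le_rpow_of_exponent_le h h1.le
      rw [Real.rpow_one] at this
      linarith
  have hRp := mul_le_mul_of_nonneg_left hp1 hR
  have hM : 0 ≤ (R + c) * ((R + c) / a) ^ (1 / γ) := by positivity
  rcases le_total (R + c) (a * x ^ γ) with h | h
  · have := mul_le_mul_of_nonneg_right h hx.le
    linarith
  · have h2 : x ^ γ ≤ (R + c) / a := by
      rw [le_div_iff₀ ha]; linarith
    have h3 : x ≤ ((R + c) / a) ^ (1 / γ) := by
      have := Real.rpow_le_rpow hp.le h2 (z := 1 / γ) (by positivity)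
      rwa [← Real.rpow_mul hx.le, mul_one_div_cancel h0.ne', Real.rpow_one] at this
    have h4 := mul_le_mul_of_nonneg_left h3 (add_nonneg hR hc)
    have : 0 ≤ a * x ^ γ * x := by positivity
    linarith

/-- Uniform upper bound `ℒV(x) ≤ K` on the positive orthant for the Lyapunov function
`V(x) = Σᵢ (xᵢ^γ − 1 − γ log xᵢ)` applied to the competitive Lotka-Volterra system. -/
theorem stmt_5 (n : ℕ) (hn : 1 ≤ n) (γ : ℝ) (hγ : γ ∈ Set.Ioo (0:ℝ) 1)
    (r σ : Fin n → ℝ) (a : Fin n → Fin n → ℝ)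
    (haii : ∀ i, 0 < a i i) (ha : ∀ i j, 0 ≤ a i j) :
    ∃ K : ℝ, ∀ x : Fin n → ℝ, (∀ i, 0 < x i) →
      (∑ i, (γ * ((x i) ^ γ - 1) * (r i - ∑ j, a i j * x j)
        + (γ / 2) * ((γ - 1) * (x i) ^ γ + 1) * (σ i) ^ 2)) ≤ K := by
  obtain ⟨h0, h1⟩ := hγ
  choose K hK using fun i => one_var_bound γ h0 h1 |r i| (∑ j, a j i) (a i i) (abs_nonneg _)
    (Finset.sum_nonneg fun j _ => ha j i) (haii i)
  refine ⟨∑ i, (γ * K i + γ / 2 * σ i ^ 2), fun x hx => ?_⟩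
  have hswap : ∑ i, ∑ j, a i j * x j = ∑ i, (∑ j, a j i) * x i := by
    rw [Finset.sum_comm]
    simp only [Finset.sum_mul]
  calc _ ≤ ∑ i, (γ * (|r i| * (x i ^ γ + 1) - a i i * x i ^ γ * x i) + γ / 2 * σ i ^ 2
            + γ * ∑ j, a i j * x j) := by
        refine Finset.sum_le_sum fun i _ => ?_
        have hp : 0 < x i ^ γ := Real.rpow_pos_of_pos (hx i) γ
        have hS : a i i * x i ≤ ∑ j, a i j * x j :=
          Finset.single_le_sum (f := fun j => a i j * x j)
            (fun j _ => mul_nonneg (ha i j) (hx j).le) (Finset.mem_univ i)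
        generalize ∑ j, a i j * x j = S at hS ⊢
        generalize x i ^ γ = p at hp ⊢
        have e1 : (p - 1) * r i ≤ |r i| * (p + 1) := by
          nlinarith [le_abs_self (r i), neg_abs_le (r i)]
        have e2 := mul_le_mul_of_nonneg_left hS hp.le
        have e3 : (p - 1) * (r i - S) ≤ |r i| * (p + 1) - a i i * p * x i + S := by linarith
        have e4 := mul_le_mul_of_nonneg_left e3 h0.le
        have e5 : 0 ≤ γ / 2 * ((1 - γ) * p) * σ i ^ 2 := by
          have : 0 < 1 - γ := by linarith
          positivity
        linarith
    _ = ∑ i, (γ * (|r i| * (x i ^ γ + 1) + (∑ j, a j i) * x i - a i i * x i ^ γ * x i)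
            + γ / 2 * σ i ^ 2) := by
        rw [Finset.sum_add_distrib, ← Finset.mul_sum, hswap, Finset.mul_sum,
          ← Finset.sum_add_distrib]
        refine Finset.sum_congr rfl fun i _ => ?_
        ring
    _ ≤ _ := by
        refine Finset.sum_le_sum fun i _ => ?_
        have := mul_le_mul_of_nonneg_left (hK i (x i) (hx i)) h0.le
        linarith
end

section
/- Let n ≥ 1 and let b̂ > 0, ã ≥ 0, σ̃ ≥ 0 and reals b̄ᵢ, σ̄ᵢ, r̄ᵢ, āᵢⱼ (1 ≤ i, j ≤ n) satisfy b̄ᵢ ≥ b̂, σ̄ᵢ² ≤ σ̃², 0 ≤ āᵢⱼ ≤ ã, and r̄ᵢ = b̄ᵢ + σ̄ᵢ²/2 for all i, j. Let θ > 0 satisfy θ σ̃² < 2 b̂ and let κ > 0 satisfy 2κ/θ < 2 b̂ − θ σ̃². Then there exists a constant K > 0 such that for every x ∈ ℝⁿ with xᵢ > 0 for all i, writing U = 1/(x₁ + ⋯ + xₙ), one has (1 + U)^{θ−2} [ (κ/θ)(1 + U)² − (1 + U) U² Σᵢ xᵢ (r̄ᵢ − Σⱼ āᵢⱼ xⱼ)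 + U³ Σᵢ σ̄ᵢ² xᵢ² + ((θ+1)/2) U⁴ Σᵢ σ̄ᵢ² xᵢ² ] ≤ K. -/
open Finset Real

theorem aux_quad (δ C1 C0 p : ℝ) (hδ : 0 < δ) (h1 : 0 ≤ C1) (h0 : 0 ≤ C0) :
    ∃ K : ℝ, 0 < K ∧ ∀ U B : ℝ, 0 < U → B ≤ -δ * U ^ 2 + C1 * U + C0 → (1 + U) ^ p * B ≤ K := by
  obtain ⟨M, hM⟩ : ∃ M, M = (C1 + C0) / δ + 1 := ⟨_, rfl⟩
  have hq : 0 ≤ (C1 + C0) / δ := by positivity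
  have hM1 : 1 ≤ M := by linarith
  have hδM : C1 + C0 ≤ δ * M := by
    rw [hM, mul_add, mul_div_cancel₀ _ hδ.ne']; linarith
  have hMp : 0 ≤ (1 + M) ^ |p| := by positivity
  have hc : 0 ≤ C1 * M + C0 := by positivity
  refine ⟨(1 + M) ^ |p| * (C1 * M + C0) + 1, by positivity, ?_⟩
  intro U B hU hB
  have hpos : 0 ≤ (1 + U) ^ p := by positivity
  rcases le_total U M with h | h
  · have e1 : (1 + U) ^ p ≤ (1 + M) ^ |p| :=
      (Real.rpow_le_rpow_of_exponent_le (by linarith) (le_abs_self p)).trans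
        (Real.rpow_le_rpow (by linarith) (by linarith) (abs_nonneg p))
    have e2 : B ≤ C1 * M + C0 := by
      have := mul_le_mul_of_nonneg_left h h1
      have : 0 ≤ δ * U ^ 2 := by positivity
      linarith
    have := mul_le_mul_of_nonneg_left e2 hpos
    have := mul_le_mul_of_nonneg_right e1 hc
    linarith
  · have e3 : B ≤ 0 := by
      have a1 : C1 + C0 ≤ δ * U := hδM.trans (mul_le_mul_of_nonneg_left h hδ.le)
      have a2 := mul_le_mul_of_nonneg_right a1 hU.le
      have a3 : C0 * 1 ≤ C0 * U := mul_le_mul_of_nonneg_left (by linarith) h0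
      nlinarith
    have := mul_nonpos_of_nonneg_of_nonpos hpos e3
    have := mul_nonneg hMp hc
    linarith

/-- Central deterministic inequality in the stochastic permanence proof: uniform bound on
the positive orthant for the generator of `J(x) = e^{κt}(1 + U(x))^θ`, `U = 1/Σᵢ xᵢ`. -/
theorem stmt_8 (n : ℕ) (hn : 1 ≤ n)
    (bhat atil σtil : ℝ) (hbhat : 0 < bhat) (hatil : 0 ≤ atil) (hσtil : 0 ≤ σtil)
    (b σ r : Fin n → ℝ) (a : Fin n → Fin n → ℝ)
    (hb : ∀ i, bhat ≤ b i) (hσ : ∀ i, (σ i) ^ 2 ≤ σtil ^ 2)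
    (ha : ∀ i j, 0 ≤ a i j ∧ a i j ≤ atil)
    (hr : ∀ i, r i = b i + (σ i) ^ 2 / 2)
    (θ κ : ℝ) (hθ : 0 < θ) (hθσ : θ * σtil ^ 2 < 2 * bhat)
    (hκ : 0 < κ) (hκθ : 2 * κ / θ < 2 * bhat - θ * σtil ^ 2) :
    ∃ K : ℝ, 0 < K ∧ ∀ x : Fin n → ℝ, (∀ i, 0 < x i) →
      (1 + (∑ i, x i)⁻¹) ^ (θ - 2) *
        ((κ / θ) * (1 + (∑ i, x i)⁻¹) ^ 2
          - (1 + (∑ i, x i)⁻¹) * ((∑ i, x i)⁻¹) ^ 2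
              * ∑ i, x i * (r i - ∑ j, a i j * x j)
          + ((∑ i, x i)⁻¹) ^ 3 * ∑ i, (σ i) ^ 2 * (x i) ^ 2
          + ((θ + 1) / 2) * ((∑ i, x i)⁻¹) ^ 4 * ∑ i, (σ i) ^ 2 * (x i) ^ 2) ≤ K := by
  obtain ⟨k, hk⟩ : ∃ k, k = κ / θ := ⟨_, rfl⟩
  have hk0 : 0 < k := by rw [hk]; positivity
  have hkk : 2 * κ / θ = 2 * k := by rw [hk]; ring
  rw [hkk] at hκθ
  obtain ⟨K, hK, H⟩ := aux_quad (bhat - θ * σtil ^ 2 / 2 - k) (2 * k + atil + σtil ^ 2)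
    (k + atil) (θ - 2) (by linarith) (by positivity) (by positivity)
  refine ⟨K, hK, ?_⟩
  intro x hx
  have hne : (Finset.univ : Finset (Fin n)).Nonempty := ⟨⟨0, hn⟩, Finset.mem_univ _⟩
  have hS : 0 < ∑ i, x i := Finset.sum_pos (fun i _ => hx i) hne
  have hle : ∀ i, x i ≤ ∑ i, x i := fun i =>
    Finset.single_le_sum (f := x) (fun j _ => (hx j).le) (Finset.mem_univ i)
  have hQW : ∑ i, (σ i) ^ 2 * (x i) ^ 2 ≤ (∑ i, x i) * ∑ i, (σ i) ^ 2 * x i := by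
    rw [Finset.mul_sum]
    refine Finset.sum_le_sum fun i _ => ?_
    have := mul_le_mul_of_nonneg_right (hle i) (mul_nonneg (sq_nonneg (σ i)) (hx i).le)
    linarith
  have hW : ∑ i, (σ i) ^ 2 * x i ≤ σtil ^ 2 * ∑ i, x i := by
    rw [Finset.mul_sum]
    exact Finset.sum_le_sum fun i _ => mul_le_mul_of_nonneg_right (hσ i) (hx i).le
  have hD : bhat * (∑ i, x i) + (∑ i, (σ i) ^ 2 * x i) / 2 - atil * (∑ i, x i) ^ 2
      ≤ ∑ i, x i * (r i - ∑ j, a i j * x j) := by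
    have e : bhat * (∑ i, x i) + (∑ i, (σ i) ^ 2 * x i) / 2 - atil * (∑ i, x i) ^ 2
      = ∑ i, x i * (bhat + (σ i) ^ 2 / 2 - atil * ∑ j, x j) := by
      have : ∀ i, x i * (bhat + (σ i) ^ 2 / 2 - atil * ∑ j, x j)
        = bhat * x i + (σ i) ^ 2 * x i / 2 - (atil * ∑ j, x j) * x i := fun i => by ring
      simp_rw [this]
      rw [Finset.sum_sub_distrib, Finset.sum_add_distrib, ← Finset.mul_sum, ← Finset.mul_sum,
        ← Finset.sum_div]
      ring
    rw [e]
    refine Finset.sum_le_sum fun i _ => mul_le_mul_of_nonneg_left ?_ (hx i).le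
    have : ∑ j, a i j * x j ≤ atil * ∑ j, x j := by
      rw [Finset.mul_sum]
      exact Finset.sum_le_sum fun j _ => mul_le_mul_of_nonneg_right (ha i j).2 (hx j).le
    have := hb i
    rw [hr i]
    linarith
  have hQ0 : 0 ≤ ∑ i, (σ i) ^ 2 * (x i) ^ 2 := Finset.sum_nonneg fun i _ => by positivity
  rw [← hk]
  generalize ∑ i, x i * (r i - ∑ j, a i j * x j) = D at *
  generalize ∑ i, (σ i) ^ 2 * (x i) ^ 2 = Q at *
  generalize ∑ i, (σ i) ^ 2 * x i = W at *
  generalize ∑ i, x i = S at *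
  have hU : 0 < S⁻¹ := inv_pos.mpr hS
  apply H _ _ hU
  have hUS : S⁻¹ * S = 1 := inv_mul_cancel₀ hS.ne'
  generalize S⁻¹ = U at *
  obtain ⟨q, hq⟩ : ∃ q, q = U ^ 2 * Q := ⟨_, rfl⟩
  obtain ⟨w, hw⟩ : ∃ w, w = U * W := ⟨_, rfl⟩
  have hq0 : 0 ≤ q := by rw [hq]; positivity
  have hqw : q ≤ w := by
    have := mul_le_mul_of_nonneg_left hQW (sq_nonneg U)
    have e : U ^ 2 * (S * W) = (U * S) * (U * W) := by ring
    rw [e, hUS, one_mul] at this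
    rw [hq, hw]; exact this
  have hwσ : w ≤ σtil ^ 2 := by
    have := mul_le_mul_of_nonneg_left hW hU.le
    have e : U * (σtil ^ 2 * S) = (U * S) * σtil ^ 2 := by ring
    rw [e, hUS, one_mul] at this
    rw [hw]; exact this
  have hD' : U * bhat + U * w / 2 - atil ≤ U ^ 2 * D := by
    have := mul_le_mul_of_nonneg_left hD (sq_nonneg U)
    have e : U ^ 2 * (bhat * S + W / 2 - atil * S ^ 2)
      = (U * S) * U * bhat + U * (U * W) / 2 - atil * (U * S) ^ 2 := by ring
    rw [e, hUS, ← hw] at this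
    linarith
  have hD2 := mul_le_mul_of_nonneg_left hD' (show 0 ≤ 1 + U by linarith)
  have e3 : U ^ 3 * Q = U * q := by rw [hq]; ring
  have e4 : (θ + 1) / 2 * U ^ 4 * Q = (θ + 1) / 2 * U ^ 2 * q := by rw [hq]; ring
  rw [e3, e4, mul_assoc (1 + U)]
  have f1 : U * q ≤ U * σtil ^ 2 := mul_le_mul_of_nonneg_left (hqw.trans hwσ) hU.le
  have f2 : U ^ 2 * q ≤ U ^ 2 * w := mul_le_mul_of_nonneg_left hqw (sq_nonneg U)
  have f3 : θ * U ^ 2 * q ≤ θ * U ^ 2 * σtil ^ 2 :=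
    mul_le_mul_of_nonneg_left (hqw.trans hwσ) (by positivity)
  have f4 : 0 ≤ U * bhat := by positivity
  have f5 : 0 ≤ U * w := mul_nonneg hU.le (hq0.trans hqw)
  linarith
end

section
/- Let n ≥ 1 and let b̂, ã ≥ 0 and reals bᵢ, σᵢ, rᵢ, aᵢⱼ (1 ≤ i, j ≤ n) satisfy bᵢ ≥ b̂, 0 ≤ aᵢⱼ ≤ ã, and rᵢ = bᵢ + σᵢ²/2 for all i, j. Then for every x ∈ ℝⁿ with xᵢ > 0 for all i, writing U = 1/(x₁ + ⋯ + xₙ), one has −(1 + U) U² Σᵢ xᵢ (rᵢ − Σⱼ aᵢⱼ xⱼ) ≤ −b̂ (1 + U) U − (1/2) U⁴ Σᵢ σᵢ² xᵢ² + ã (1 + U). -/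
open Finset

/-- Estimate of the cross term in the generator computation for the Lyapunov function
`(1 + U)^θ`, where `U = 1/(x₁ + ⋯ + xₙ)`, in the stochastic permanence proof. -/
theorem stmt_9 (n : ℕ) (hn : 1 ≤ n)
    (bhat atil : ℝ) (hbhat : 0 ≤ bhat) (hatil : 0 ≤ atil)
    (b σ r : Fin n → ℝ) (a : Fin n → Fin n → ℝ)
    (hb : ∀ i, bhat ≤ b i) (ha : ∀ i j, 0 ≤ a i j ∧ a i j ≤ atil)
    (hr : ∀ i, r i = b i + (σ i) ^ 2 / 2)
    (x : Fin n → ℝ) (hx : ∀ i, 0 < x i) :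
    -(1 + (∑ i, x i)⁻¹) * ((∑ i, x i)⁻¹) ^ 2 * ∑ i, x i * (r i - ∑ j, a i j * x j)
      ≤ -bhat * (1 + (∑ i, x i)⁻¹) * (∑ i, x i)⁻¹
        - (1 / 2) * ((∑ i, x i)⁻¹) ^ 4 * ∑ i, (σ i) ^ 2 * (x i) ^ 2
        + atil * (1 + (∑ i, x i)⁻¹) := by
  have hS : 0 < ∑ i, x i := by
    haveI : Nonempty (Fin n) := ⟨⟨0, hn⟩⟩
    exact Finset.sum_pos (fun i _ => hx i) Finset.univ_nonempty
  have hle : ∀ i, x i ≤ ∑ i, x i := fun i =>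
    Finset.single_le_sum (f := x) (fun j _ => (hx j).le) (Finset.mem_univ i)
  have hA : ∀ i, ∑ j, a i j * x j ≤ atil * ∑ j, x j := by
    intro i
    rw [Finset.mul_sum]
    exact Finset.sum_le_sum fun j _ => mul_le_mul_of_nonneg_right (ha i j).2 (hx j).le
  have hP : 0 ≤ ∑ i, (σ i) ^ 2 * (x i) ^ 2 := Finset.sum_nonneg fun i _ => by positivity
  have hPQ : ∑ i, (σ i) ^ 2 * (x i) ^ 2 ≤ (∑ i, x i) * ∑ i, (σ i) ^ 2 * x i := by
    rw [Finset.mul_sum]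
    refine Finset.sum_le_sum fun i _ => ?_
    have h := mul_le_mul_of_nonneg_left (hle i) (mul_nonneg (sq_nonneg (σ i)) (hx i).le)
    nlinarith [h]
  have hT : bhat * (∑ i, x i) + (1 / 2) * (∑ i, (σ i) ^ 2 * x i)
      - (atil * ∑ i, x i) * (∑ i, x i) ≤ ∑ i, x i * (r i - ∑ j, a i j * x j) := by
    have e : bhat * (∑ i, x i) + (1 / 2) * (∑ i, (σ i) ^ 2 * x i)
        - (atil * ∑ i, x i) * (∑ i, x i)
        = ∑ i, (bhat * x i + (1 / 2) * ((σ i) ^ 2 * x i) - (atil * ∑ j, x j) * x i) := by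
      rw [Finset.sum_sub_distrib, Finset.sum_add_distrib, ← Finset.mul_sum, ← Finset.mul_sum,
        ← Finset.mul_sum]
    rw [e]
    refine Finset.sum_le_sum fun i _ => ?_
    rw [hr i]
    nlinarith [mul_le_mul_of_nonneg_right (hA i) (hx i).le,
      mul_le_mul_of_nonneg_right (hb i) (hx i).le]
  generalize (∑ i, x i * (r i - ∑ j, a i j * x j)) = T at *
  generalize (∑ i, (σ i) ^ 2 * (x i) ^ 2) = P at *
  generalize (∑ i, (σ i) ^ 2 * x i) = Q at *
  generalize (∑ i, x i) = S at *
  have hU : 0 < S⁻¹ := inv_pos.mpr hS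
  have hSU : S * S⁻¹ = 1 := mul_inv_cancel₀ hS.ne'
  generalize S⁻¹ = U at *
  have h1 := mul_le_mul_of_nonneg_left hT (by positivity : 0 ≤ (1 + U) * U ^ 2)
  have h2 := mul_le_mul_of_nonneg_left hPQ (by positivity : 0 ≤ (1 + U) * U ^ 3)
  have h3 : 0 ≤ U ^ 3 * P := by positivity
  have e1 : (1 + U) * U ^ 2 * (bhat * S + 1 / 2 * Q - atil * S * S)
      = bhat * (1 + U) * U + (1 / 2) * ((1 + U) * U ^ 2 * Q) - atil * (1 + U) := by
    linear_combination (bhat * (1 + U) * U - atil * (1 + U) * (S * U + 1)) * hSU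
  have e2 : (1 + U) * U ^ 3 * (S * Q) = (1 + U) * U ^ 2 * Q := by
    linear_combination ((1 + U) * U ^ 2 * Q) * hSU
  rw [e1] at h1
  rw [e2] at h2
  linarith
end
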